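/- arXiv:1907.00421 — 2 statements merged into one kernel-verified Lean document; each statement's English description precedes it below -/
import Mathlib

section
/- Let M = (Q,q₀,δ) be a communicating machine, Q' ⊆ Q'' ⊆ Q finite sets of states, k ∈ ℕ and ψ ∈ Act*. If minAcc(k,Q',ψ) and minAcc(k,Q'',ψ) are both defined, then minAcc(k,Q'',ψ) ≤ minAcc(k,Q',ψ). -/
namespace AsyncSession

/-- Actions: send `!a` or receive `?a` over an alphabet `A`. -/
inductive Act (A : Type) : Type
  | send : A → Act A
  | recv : A → Act A

/-- Direction of an action: `true` for send, `false` for receive. -/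
def Act.dir {A : Type} : Act A → Bool
  | .send _ => true
  | .recv _ => false

/-- A (deterministic, directed) communicating machine with states `S`
    over alphabet `A`. -/
structure Machine (A S : Type) where
  init : S
  trans : S → Act A → S → Prop
  directed : ∀ q ℓ q' ℓ' q'', trans q ℓ q' → trans q ℓ' q'' → Act.dir ℓ = Act.dir ℓ'
  deterministic : ∀ q ℓ q' q'', trans q ℓ q' → trans q ℓ q'' → q' = q''

variable {A P Q S V W' : Type}

/-- A state is final iff it has no outgoing transitions. -/
def Machine.Final (M : Machine A S) (q : S) : Prop := ∀ ℓ q', ¬ M.trans q ℓ q'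

/-- A state is sending iff it is not final and all its transitions are sends. -/
def Machine.Sending (M : Machine A S) (q : S) : Prop :=
  ¬ M.Final q ∧ ∀ ℓ q', M.trans q ℓ q' → Act.dir ℓ = true

/-- A state is receiving iff it is not final and all its transitions are receives. -/
def Machine.Receiving (M : Machine A S) (q : S) : Prop :=
  ¬ M.Final q ∧ ∀ ℓ q', M.trans q ℓ q' → Act.dir ℓ = false

/-- `in(q)`: messages receivable at `q`. -/
def Machine.inSet (M : Machine A S) (q : S) : Set A := {a | ∃ q', M.trans q (.recv a) q'}

/-- `out(q)`: messages sendable at `q`. -/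
def Machine.outSet (M : Machine A S) (q : S) : Set A := {a | ∃ q', M.trans q (.send a) q'}

/-- Multi-step transition along a list of actions. -/
inductive ActPath (M : Machine A S) : S → List (Act A) → S → Prop
  | nil (q : S) : ActPath M q [] q
  | cons {q : S} {ℓ : Act A} {q₁ : S} {ψ : List (Act A)} {q' : S} :
      M.trans q ℓ q₁ → ActPath M q₁ ψ q' → ActPath M q (ℓ :: ψ) q'

/-- `cycle(!,q)`: a cycle of send actions is reachable from `q` via sends. -/
def SendCycle (M : Machine A S) (q : S) : Prop :=
  ∃ (ω ω' : List A) (q' : S),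
    ActPath M q (ω.map Act.send) q' ∧ ω' ≠ [] ∧ ActPath M q' (ω'.map Act.send) q'

/-- Input trees over alphabet `A` and states `S`: either a single state (a hole
filled with a state), or a nonempty finite input branching `⟨a_i : T_i⟩`. -/
inductive ITree (A S : Type) : Type
  | leaf : S → ITree A S
  | node : (dom : Finset A) → dom.Nonempty → ((a : A) → a ∈ dom → ITree A S) → ITree A S

/-- The set of states occurring at the leaves of an input tree (equivalently, the
states in the holes of the corresponding input context). -/
def ITree.leaves : ITree A S → Set S
  | .leaf q => {q}
  | .node dom _ f => {s | ∃ (a : A) (h : a ∈ dom), s ∈ (f a h).leaves}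

/-- `minHeight`: the length of a shortest root-to-leaf (root-to-hole) path. -/
noncomputable def ITree.minHeight : ITree A S → ℕ
  | .leaf _ => 0
  | .node dom _ f => 1 + sInf {h | ∃ (a : A) (ha : a ∈ dom), (f a ha).minHeight = h}
termination_by structural t => t

open Classical in
/-- `extract(𝒜,ω)`: follow the word `ω` of input messages down the tree. -/
noncomputable def ITree.extract : ITree A S → List A → Option (ITree A S)
  | t, [] => some t
  | .leaf _, _ :: _ => none
  | .node dom _ f, a :: ω => if h : a ∈ dom then (f a h).extract ω else none
termination_by structural t => t

/-- Replace every leaf `q` of a tree by some tree `t` with `R q t`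
(filling of an input context, relationally). -/
inductive ReplaceLeaves (R : S → ITree A S → Prop) : ITree A S → ITree A S → Prop
  | leaf {q : S} {t : ITree A S} : R q t → ReplaceLeaves R (.leaf q) t
  | node {dom : Finset A} {hne : dom.Nonempty} {f g : (a : A) → a ∈ dom → ITree A S} :
      (∀ a (h : a ∈ dom), ReplaceLeaves R (f a h) (g a h)) →
      ReplaceLeaves R (.node dom hne f) (.node dom hne g)

/-- `InTree M q T` holds iff `inTree(q)` is defined and equals `T`. -/
inductive InTree (M : Machine A S) : S → ITree A S → Prop
  | leaf {q : S} : M.inSet q = ∅ → InTree M q (.leaf q)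
  | node {q : S} {dom : Finset A} {hne : dom.Nonempty}
      {f : (a : A) → a ∈ dom → ITree A S} :
      (↑dom : Set A) = M.inSet q →
      (∀ a (h : a ∈ dom), ∀ q', M.trans q (.recv a) q' → InTree M q' (f a h)) →
      InTree M q (.node dom hne f)

/-- `AccTree M ω q t` holds iff `accTree(q,ω)` is defined and equals `t`. -/
def AccTree (M : Machine A S) : List A → S → ITree A S → Prop
  | [], q, t => t = .leaf q
  | a :: ω, q, t =>
      ∃ T, InTree M q T ∧
        ReplaceLeaves (fun p t' => ∃ p', M.trans p (.send a) p' ∧ AccTree M ω p' t') T t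

/-- `rcv(ψ)`: the messages of the receive actions in `ψ`, in order. -/
def rcvWord (ψ : List (Act A)) : List A :=
  ψ.filterMap fun ℓ => match ℓ with | .recv a => some a | .send _ => none

/-- `snd(ψ)`: the messages of the send actions in `ψ`, in order. -/
def sndWord (ψ : List (Act A)) : List A :=
  ψ.filterMap fun ℓ => match ℓ with | .send a => some a | .recv _ => none

/-- `MinAcc M ψ k Qs r` holds iff `minAcc(k,Qs,ψ)` is defined and equals `r`. -/
def MinAcc (M : Machine A S) : List (Act A) → ℕ → Set S → ℕ → Prop
  | [], k, _, r => r = k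
  | .recv _ :: ψ, k, Qs, r => 0 < k ∧ MinAcc M ψ (k - 1) Qs r
  | .send a :: ψ, k, Qs, r =>
      Qs.Nonempty ∧
      ∃ T : S → ITree A S,
        (∀ q ∈ Qs, AccTree M [a] q (T q)) ∧
        MinAcc M ψ (k + sInf {h | ∃ q ∈ Qs, (T q).minHeight = h})
          {q' | ∃ q ∈ Qs, q' ∈ (T q).leaves} r

/-- One step of the asynchronous subtyping simulation game, on configurations
`(p,T)` with `p` a state of `M₁` and `T` an input tree over the states of `M₂`.
The four rules are (In), (Out), (InCtx) and (OutAcc). -/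
inductive Step (M1 : Machine A P) (M2 : Machine A Q) :
    P × ITree A Q → Act A → P × ITree A Q → Prop
  | inp {p : P} {q : Q} {a : A} {p' : P} {q' : Q} :
      M1.trans p (.recv a) p' → M2.trans q (.recv a) q' →
      M2.inSet q ⊆ M1.inSet p →
      Step M1 M2 (p, .leaf q) (.recv a) (p', .leaf q')
  | out {p : P} {q : Q} {a : A} {p' : P} {q' : Q} :
      M1.trans p (.send a) p' → M2.trans q (.send a) q' →
      M1.outSet p ⊆ M2.outSet q →
      Step M1 M2 (p, .leaf q) (.send a) (p', .leaf q')
  | inCtx {p : P} {a : A} {p' : P} {dom : Finset A} {hne : dom.Nonempty}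
      {f : (b : A) → b ∈ dom → ITree A Q} (h : a ∈ dom) :
      M1.trans p (.recv a) p' → (↑dom : Set A) ⊆ M1.inSet p →
      Step M1 M2 (p, .node dom hne f) (.recv a) (p', f a h)
  | outAcc {p : P} {a : A} {p' : P} {T T' : ITree A Q} :
      M1.trans p (.send a) p' → ¬ SendCycle M1 p →
      ReplaceLeaves (fun q t => ∃ U, InTree M2 q U ∧
          ReplaceLeaves (fun qh t' => M1.outSet p ⊆ M2.outSet qh ∧
              ∃ q', M2.trans qh (.send a) q' ∧ t' = .leaf q') U t) T T' →
      Step M1 M2 (p, T) (.send a) (p', T')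

/-- The root configuration of the simulation tree. -/
def initConfig (M1 : Machine A P) (M2 : Machine A Q) : P × ITree A Q :=
  (M1.init, .leaf M2.init)

def StepAny (M1 : Machine A P) (M2 : Machine A Q) (c c' : P × ITree A Q) : Prop :=
  ∃ ℓ, Step M1 M2 c ℓ c'

/-- Configurations reachable from the root, i.e. the labels of the nodes of
the simulation tree `simtree(M₁,M₂)`. -/
def CReach (M1 : Machine A P) (M2 : Machine A Q) (c : P × ITree A Q) : Prop :=
  Relation.ReflTransGen (StepAny M1 M2) (initConfig M1 M2) c

/-- A successful leaf: a pair of final states with empty input context. -/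
def SuccessfulConfig (M1 : Machine A P) (M2 : Machine A Q) (c : P × ITree A Q) : Prop :=
  ∃ p q, c = (p, ITree.leaf q) ∧ M1.Final p ∧ M2.Final q

/-- All branches of `simtree(M₁,M₂)` are successful: every branch is infinite or
ends in a successful leaf, i.e. every reachable node without successors is a
successful leaf. -/
def AllBranchesSuccessful (M1 : Machine A P) (M2 : Machine A Q) : Prop :=
  ∀ c, CReach M1 M2 c → (∀ ℓ c', ¬ Step M1 M2 c ℓ c') → SuccessfulConfig M1 M2 c

/-- Asynchronous subtyping relations (Definition of asynchronous subtyping). -/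
def IsSubtypingRel (M1 : Machine A P) (M2 : Machine A Q)
    (R : P → ITree A Q → Prop) : Prop :=
  ∀ p T, R p T →
    (M1.Final p → ∃ q, T = ITree.leaf q ∧ M2.Final q) ∧
    (M1.Receiving p →
      (∀ q, T = ITree.leaf q →
        M2.Receiving q ∧
        ∀ a q', M2.trans q (.recv a) q' →
          ∃ p', M1.trans p (.recv a) p' ∧ R p' (ITree.leaf q')) ∧
      (∀ (dom : Finset A) (hne : dom.Nonempty) (f : (a : A) → a ∈ dom → ITree A Q),
        T = ITree.node dom hne f →
        ∀ a (h : a ∈ dom), ∃ p', M1.trans p (.recv a) p' ∧ R p' (f a h))) ∧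
    (M1.Sending p →
      (∀ q, T = ITree.leaf q → M2.Sending q →
        ∀ a p', M1.trans p (.send a) p' →
          ∃ q', M2.trans q (.send a) q' ∧ R p' (ITree.leaf q')) ∧
      ((¬ ∃ q, T = ITree.leaf q ∧ M2.Sending q) →
        ¬ SendCycle M1 p ∧
        (∀ q ∈ T.leaves, ∃ U, InTree M2 q U) ∧
        (∀ a p', M1.trans p (.send a) p' →
          ∃ T', ReplaceLeaves (fun q t => ∃ U, InTree M2 q U ∧
              ReplaceLeaves (fun qh t' => ∃ q', M2.trans qh (.send a) q' ∧
                  t' = ITree.leaf q') U t) T T' ∧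
            R p' T')))

/-- `M₁ ≤ M₂`: asynchronous session subtyping. -/
def Subtyping (M1 : Machine A P) (M2 : Machine A Q) : Prop :=
  ∃ R, IsSubtypingRel M1 M2 R ∧ R M1.init (ITree.leaf M2.init)

/-! ### Nodes of the simulation tree and (candidate/witness) subtrees -/

/-- A node of the simulation tree: the sequence of edge labels from the root
together with the configuration labelling the node. -/
abbrev SNode (A P Q : Type) := List (Act A) × (P × ITree A Q)

/-- The root node of the simulation tree. -/
def rootNode (M1 : Machine A P) (M2 : Machine A Q) : SNode A P Q :=
  ([], initConfig M1 M2)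

/-- Labelled edges of the simulation tree. -/
def Edge (M1 : Machine A P) (M2 : Machine A Q)
    (n : SNode A P Q) (ℓ : Act A) (n' : SNode A P Q) : Prop :=
  n'.1 = n.1 ++ [ℓ] ∧ Step M1 M2 n.2 ℓ n'.2

def EdgeAny (M1 : Machine A P) (M2 : Machine A Q) (n n' : SNode A P Q) : Prop :=
  ∃ ℓ, Edge M1 M2 n ℓ n'

/-- `n ↝* n'`. -/
def NReach (M1 : Machine A P) (M2 : Machine A Q) : SNode A P Q → SNode A P Q → Prop :=
  Relation.ReflTransGen (EdgeAny M1 M2)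

/-- `n ↝⁺ n'`. -/
def NReachPlus (M1 : Machine A P) (M2 : Machine A Q) : SNode A P Q → SNode A P Q → Prop :=
  Relation.TransGen (EdgeAny M1 M2)

/-- `n ↝^ψ n'`: path with label sequence `ψ`. -/
inductive EdgePath (M1 : Machine A P) (M2 : Machine A Q) :
    SNode A P Q → List (Act A) → SNode A P Q → Prop
  | nil (n : SNode A P Q) : EdgePath M1 M2 n [] n
  | cons {n : SNode A P Q} {ℓ : Act A} {n₁ : SNode A P Q} {ψ : List (Act A)}
      {n' : SNode A P Q} :
      Edge M1 M2 n ℓ n₁ → EdgePath M1 M2 n₁ ψ n' → EdgePath M1 M2 n (ℓ :: ψ) n'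

/-- Data of a subtree of the simulation tree: a root `r`, a boundary `B`, and an
ancestor function `anc` (only its values on `B` matter). -/
structure SubtreeData (A P Q : Type) where
  r : SNode A P Q
  B : Set (SNode A P Q)
  anc : SNode A P Q → SNode A P Q

/-- `nodes(r,B)`: the nodes of the finite subtree. -/
def SubtreeData.nodes (W : SubtreeData A P Q) (M1 : Machine A P) (M2 : Machine A Q) :
    Set (SNode A P Q) :=
  {n | NReach M1 M2 W.r n ∧ ∃ b ∈ W.B, NReach M1 M2 n b}

/-- `(r,B)` is a finite subtree of `simtree(M₁,M₂)`. -/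
def SubtreeData.IsFiniteSubtree (W : SubtreeData A P Q)
    (M1 : Machine A P) (M2 : Machine A Q) : Prop :=
  NReach M1 M2 (rootNode M1 M2) W.r ∧
  W.B.Finite ∧
  (∀ n ∈ W.B, NReach M1 M2 W.r n) ∧
  (∀ n ∈ W.B, ∀ n' ∈ W.B, ¬ NReachPlus M1 M2 n n') ∧
  (∀ n, NReach M1 M2 W.r n → ∃ n' ∈ W.B, NReach M1 M2 n n' ∨ NReach M1 M2 n' n)

/-- `(r,B,anc)` is a candidate subtree of `simtree(M₁,M₂)`. -/
def SubtreeData.IsCandidate (W : SubtreeData A P Q)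
    (M1 : Machine A P) (M2 : Machine A Q) : Prop :=
  W.IsFiniteSubtree M1 M2 ∧
  ∀ n ∈ W.B,
    W.anc n ∈ W.nodes M1 M2 \ W.B ∧
    NReachPlus M1 M2 (W.anc n) n ∧
    n.2.1 = (W.anc n).2.1 ∧
    (n.2.2).leaves ⊆ ((W.anc n).2.2).leaves

/-- `tr(n)`: `n` itself if it is not a boundary node, its ancestor otherwise. -/
noncomputable def SubtreeData.tr (W : SubtreeData A P Q) (n : SNode A P Q) : SNode A P Q := by
  classical exact if n ∈ W.B then W.anc n else n

/-! ### Input tree expressions, systems of input tree equations, compatibility -/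

/-- Input tree expressions over alphabet `A` and variables `V`:
variables, input choices, and silent choices. -/
inductive ITExpr (A V : Type) : Type
  | var : V → ITExpr A V
  | inp : (dom : Finset A) → dom.Nonempty → ((a : A) → a ∈ dom → ITExpr A V) → ITExpr A V
  | sil : ITExpr A V → List (ITExpr A V) → ITExpr A V

/-- Turn an input tree into an input tree expression by replacing each leaf
state `q` by the variable `v q`. -/
def ITree.toExprVar : ITree A S → (S → V) → ITExpr A V
  | .leaf q, v => .var (v q)
  | .node dom hne f, v => .inp dom hne fun a h => (f a h).toExprVar v

/-- Relational version: replace each leaf `q` by some expression `e` with `R q e`. -/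
inductive ToExpr (R : S → ITExpr A V → Prop) : ITree A S → ITExpr A V → Prop
  | leaf {q : S} {e : ITExpr A V} : R q e → ToExpr R (.leaf q) e
  | node {dom : Finset A} {hne : dom.Nonempty} {f : (a : A) → a ∈ dom → ITree A S}
      {g : (a : A) → a ∈ dom → ITExpr A V} :
      (∀ a (h : a ∈ dom), ToExpr R (f a h) (g a h)) →
      ToExpr R (.node dom hne f) (.inp dom hne g)

/-- Compatibility relations between two systems of input tree equations, given by
their definition maps `defL` and `defR`. -/
def IsCompatRel (defL : V → ITExpr A V) (defR : W' → ITExpr A W')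
    (R : ITExpr A V → ITExpr A W' → Prop) : Prop :=
  (∀ (X : V) (E : ITExpr A W'), R (.var X) E → R (defL X) E) ∧
  (∀ (E : ITExpr A V) (X : W'), R E (.var X) → R E (defR X)) ∧
  (∀ (e₀ : ITExpr A V) (es : List (ITExpr A V)) (E : ITExpr A W'),
      R (.sil e₀ es) E → ∀ e ∈ e₀ :: es, R e E) ∧
  (∀ (E : ITExpr A V) (e₀ : ITExpr A W') (es : List (ITExpr A W')),
      R E (.sil e₀ es) → ∀ e ∈ e₀ :: es, R E e) ∧
  (∀ (dom : Finset A) (hne : dom.Nonempty) (f : (a : A) → a ∈ dom → ITExpr A V)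
      (dom' : Finset A) (hne' : dom'.Nonempty) (g : (a : A) → a ∈ dom' → ITExpr A W'),
      R (.inp dom hne f) (.inp dom' hne' g) →
      dom ⊆ dom' ∧ ∀ a (h : a ∈ dom) (h' : a ∈ dom'), R (f a h) (g a h'))

/-- `E ⊑ E'`: compatibility of two expressions w.r.t. the definition maps. -/
def Compat (defL : V → ITExpr A V) (defR : W' → ITExpr A W')
    (E : ITExpr A V) (E' : ITExpr A W') : Prop :=
  ∃ R, IsCompatRel defL defR R ∧ R E E'

/-- Specification of the system `𝒢` of condition (3a) of the witness-subtree
definition: variables are `X₀` (`none`) and `X_{q,n}` (`some (q,n)`). -/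
def GSpec (M1 : Machine A P) (M2 : Machine A Q) (W : SubtreeData A P Q)
    (EG : Option (Q × SNode A P Q) → ITExpr A (Option (Q × SNode A P Q))) : Prop :=
  ToExpr (fun q e => e = .var (some (q, W.r))) (W.r.2.2) (EG none) ∧
  ∀ (q : Q), ∀ n ∈ W.nodes M1 M2 \ W.B,
    ((∃ a n', Edge M1 M2 n (.recv a) n') →
       ∃ e₀ es, EG (some (q, n)) = .sil e₀ es ∧
         ∀ e, e ∈ e₀ :: es ↔ ∃ a n', Edge M1 M2 n (.recv a) n' ∧
           e = .var (some (q, W.tr n'))) ∧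
    ((¬ ∃ a n', Edge M1 M2 n (.recv a) n') → (∃ a n', Edge M1 M2 n (.send a) n') →
       ∃ e₀ es, EG (some (q, n)) = .sil e₀ es ∧
         ∀ e, e ∈ e₀ :: es ↔ ∃ a n', Edge M1 M2 n (.send a) n' ∧
           ∃ U, InTree M2 q U ∧
             ToExpr (fun qi e' => ∃ q', M2.trans qi (.send a) q' ∧
               e' = .var (some (q', W.tr n'))) U e)

/-- Specification of the system `𝒢'` of condition (3b) of the witness-subtree
definition: variables are `Y_n`. -/
def G'Spec (M1 : Machine A P) (M2 : Machine A Q) (W : SubtreeData A P Q)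
    (EG' : SNode A P Q → ITExpr A (SNode A P Q)) : Prop :=
  ∀ n ∈ W.nodes M1 M2 \ W.B,
    ((∃ a n', Edge M1 M2 n (.send a) n') →
       ∃ e₀ es, EG' n = .sil e₀ es ∧
         ∀ e, e ∈ e₀ :: es ↔ ∃ a n', Edge M1 M2 n (.send a) n' ∧ e = .var (W.tr n')) ∧
    ((∃ a n', Edge M1 M2 n (.recv a) n') →
       ∃ (dom : Finset A) (hne : dom.Nonempty) (g : (a : A) → a ∈ dom → ITExpr A (SNode A P Q)),
         EG' n = .inp dom hne g ∧
         (↑dom : Set A) = {a | ∃ n', Edge M1 M2 n (.recv a) n'} ∧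
         ∀ a (h : a ∈ dom), ∀ n', Edge M1 M2 n (.recv a) n' → g a h = .var (W.tr n'))

/-- `(r,B,anc)` is a witness subtree of `simtree(M₁,M₂)`. -/
def SubtreeData.IsWitness (W : SubtreeData A P Q)
    (M1 : Machine A P) (M2 : Machine A Q) : Prop :=
  W.IsCandidate M1 M2 ∧
  -- (1) at least one receive action between an ancestor and its boundary node
  (∀ n ∈ W.B, ∀ ψ, EdgePath M1 M2 (W.anc n) ψ n → 0 < (rcvWord ψ).length) ∧
  -- (2) conditions (2a) and (2b)
  (∀ n ∈ W.anc '' W.B, ∀ n' ∈ W.anc '' W.B ∪ W.B, ∀ ψ, EdgePath M1 M2 n ψ n' →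
    (∀ q ∈ (n.2.2).leaves,
        ∃ t, AccTree M2 (sndWord ψ) q t ∧ t.leaves ⊆ (n'.2.2).leaves) ∧
    (n' ∈ W.B →
        ∃ m, MinAcc M2 ψ ((n.2.2).minHeight) ((n.2.2).leaves) m ∧
          (n.2.2).minHeight ≤ m)) ∧
  -- (3) compatibility of the two systems of input tree equations
  (∃ EG EG', GSpec M1 M2 W EG ∧ G'Spec M1 M2 W EG' ∧
      Compat EG EG' (ITExpr.var none) (ITExpr.var W.r))


theorem InTree_unique (M : Machine A S) {q : S} {T T' : ITree A S}
    (h : InTree M q T) (h' : InTree M q T') : T = T' := by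
  induction h generalizing T' with
  | leaf he =>
    cases h' with
    | leaf _ => rfl
    | @node _ dom hne f hd hf =>
      exfalso
      obtain ⟨a, ha⟩ := hne
      have : a ∈ (↑dom : Set A) := ha
      rw [hd, he] at this
      exact this
  | @node q dom hne f hd hf ih =>
    cases h' with
    | leaf he =>
      exfalso
      obtain ⟨a, ha⟩ := hne
      have : a ∈ (↑dom : Set A) := ha
      rw [hd, he] at this
      exact this
    | @node _ dom' hne' f' hd' hf' =>
      have e : dom = dom' := by
        apply Finset.coe_injective
        rw [hd, hd']
      subst e
      congr 1
      funext a ha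
      have : a ∈ (↑dom : Set A) := ha
      rw [hd] at this
      obtain ⟨q', hq'⟩ := this
      exact ih a ha q' hq' (hf' a ha q' hq')

theorem ReplaceLeaves_unique {R : S → ITree A S → Prop}
    (hR : ∀ q t t', R q t → R q t' → t = t') {T t t' : ITree A S}
    (h : ReplaceLeaves R T t) (h' : ReplaceLeaves R T t') : t = t' := by
  induction h generalizing t' with
  | leaf hq =>
    cases h' with
    | leaf hq' => exact hR _ _ _ hq hq'
  | node hf ih =>
    cases h' with
    | node hf' =>
      congr 1
      funext a ha
      exact ih a ha (hf' a ha)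

theorem AccTree_unique (M : Machine A S) (ω : List A) (q : S) (t t' : ITree A S)
    (h : AccTree M ω q t) (h' : AccTree M ω q t') : t = t' := by
  induction ω generalizing q t t' with
  | nil => exact Eq.trans h (Eq.symm h')
  | cons a ω ih =>
    obtain ⟨T, hT, hr⟩ := h
    obtain ⟨T', hT', hr'⟩ := h'
    obtain rfl := InTree_unique M hT hT'
    refine ReplaceLeaves_unique ?_ hr hr'
    rintro p u u' ⟨p', hp, hu⟩ ⟨p'', hp', hu'⟩
    obtain rfl := M.deterministic _ _ _ _ hp hp'
    exact ih _ _ _ hu hu'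

theorem MinAcc_mono_aux (M : Machine A S) (ψ : List (Act A)) :
    ∀ (Qs Qs' : Set S) (_ : Qs ⊆ Qs') (k k' r r' : ℕ) (_ : k' ≤ k)
      (_ : MinAcc M ψ k Qs r) (_ : MinAcc M ψ k' Qs' r'), r' ≤ r := by
  induction ψ with
  | nil =>
    intro Qs Qs' hsub k k' r r' hk h h'
    simp only [MinAcc] at h h'
    omega
  | cons ℓ ψ ih =>
    intro Qs Qs' hsub k k' r r' hk h h'
    cases ℓ with
    | recv a => exact ih Qs Qs' hsub (k - 1) (k' - 1) r r' (by omega) h.2 h'.2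
    | send a =>
      obtain ⟨⟨q₀, hq₀⟩, T, hT, hm⟩ := h
      obtain ⟨_, T', hT', hm'⟩ := h'
      have e : ∀ q ∈ Qs, T q = T' q := fun q hq =>
        AccTree_unique M _ _ _ _ (hT q hq) (hT' q (hsub hq))
      refine ih _ _ ?_ _ _ r r' ?_ hm hm'
      · rintro s ⟨q, hq, hs⟩
        exact ⟨q, hsub hq, e q hq ▸ hs⟩
      · refine Nat.add_le_add hk ?_
        obtain ⟨q, hq, hh⟩ := Nat.sInf_mem
          (s := {h | ∃ q ∈ Qs, (T q).minHeight = h}) ⟨_, q₀, hq₀, rfl⟩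
        exact Nat.sInf_le ⟨q, hsub hq, e q hq ▸ hh⟩

/-- Proposition, item 3. `minAcc` is antitone in the set of
states: if `Q' ⊆ Q''` and both values are defined then
`minAcc(k,Q'',ψ) ≤ minAcc(k,Q',ψ)`. -/
theorem minAcc_antitone_states
    {A S : Type} [Fintype A] [Fintype S]
    (M : Machine A S) (Qs Qs' : Set S) (hsub : Qs ⊆ Qs')
    (ψ : List (Act A)) (k r r' : ℕ)
    (h : MinAcc M ψ k Qs r) (h' : MinAcc M ψ k Qs' r') :
    r' ≤ r := by
  exact MinAcc_mono_aux M ψ Qs Qs' hsub k k r r' le_rfl h h'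

end AsyncSession
end

section
/- Let M₁ = (P,p₀,δ₁) and M₂ = (Q,q₀,δ₂) be two communicating machines. If the simulation tree simtree(M₁,M₂) contains an unsuccessful leaf (a node without successors whose label is not a pair of final states), then M₁ is not an asynchronous subtype of M₂ (M₁ ≰ M₂). -/
namespace AsyncSession

variable {A P Q S V W' : Type}

theorem RL_mono {A S : Type} {R R' : S → ITree A S → Prop} (h : ∀ q t, R q t → R' q t)
    {T T' : ITree A S} (hr : ReplaceLeaves R T T') : ReplaceLeaves R' T T' := by
  induction hr with
  | leaf hq => exact .leaf (h _ _ hq)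
  | node _ ih => exact .node ih

theorem RL_fun {A S : Type} {R : S → ITree A S → Prop}
    (h : ∀ q t t', R q t → R q t' → t = t')
    {T T' T'' : ITree A S} (hr : ReplaceLeaves R T T') (hr' : ReplaceLeaves R T T'') :
    T' = T'' := by
  induction hr generalizing T'' with
  | leaf hq =>
    cases hr' with
    | leaf hq' => exact h _ _ _ hq hq'
  | node _ ih =>
    cases hr' with
    | node hg =>
      congr 1
      funext a ha
      exact ih a ha (hg a ha)

theorem RL_and {A S : Type} {R : S → ITree A S → Prop} {B : Set A}
    {Rb : A → S → ITree A S → Prop}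
    {T T' : ITree A S} (hr : ReplaceLeaves R T T')
    (hb : ∀ b ∈ B, ∃ Tb, ReplaceLeaves (Rb b) T Tb) :
    ReplaceLeaves (fun q t => R q t ∧ ∀ b ∈ B, ∃ tb, Rb b q tb) T T' := by
  induction hr with
  | leaf hq =>
    refine .leaf ⟨hq, fun b h => ?_⟩
    obtain ⟨Tb, h⟩ := hb b h
    cases h with
    | leaf h => exact ⟨_, h⟩
  | node _ ih =>
    refine .node fun a ha => ih a ha fun b h => ?_
    obtain ⟨Tb, h⟩ := hb b h
    cases h with
    | node h => exact ⟨_, h a ha⟩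

theorem InTree_fun {A S : Type} {M : Machine A S} {q : S} {T T' : ITree A S}
    (h : InTree M q T) (h' : InTree M q T') : T = T' := by
  induction h generalizing T' with
  | leaf he =>
    cases h' with
    | leaf _ => rfl
    | @node _ dom hne f hd _ =>
      rw [he] at hd
      simp at hd
      simp [hd] at hne
  | @node q dom hne f hd hf ih =>
    cases h' with
    | leaf he =>
      rw [he] at hd
      simp at hd
      simp [hd] at hne
    | @node _ dom' hne' f' hd' hf' =>
      have : dom = dom' := Finset.coe_injective (hd.trans hd'.symm)
      subst this
      congr 1
      funext a ha
      have : a ∈ M.inSet q := hd ▸ ha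
      obtain ⟨q', hq'⟩ := this
      exact ih a ha q' hq' (hf' a ha q' hq')

theorem acc_fun {A S : Type} {M : Machine A S} {a : A} {T T' T'' : ITree A S}
    (h : ReplaceLeaves (fun q t => ∃ U, InTree M q U ∧
              ReplaceLeaves (fun qh t' => ∃ q', M.trans qh (.send a) q' ∧
                  t' = ITree.leaf q') U t) T T')
    (h' : ReplaceLeaves (fun q t => ∃ U, InTree M q U ∧
              ReplaceLeaves (fun qh t' => ∃ q', M.trans qh (.send a) q' ∧
                  t' = ITree.leaf q') U t) T T'') : T' = T'' := by
  refine RL_fun ?_ h h'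
  rintro q t t' ⟨U, hU, h1⟩ ⟨U', hU', h2⟩
  obtain rfl := InTree_fun hU hU'
  refine RL_fun ?_ h1 h2
  rintro q t t' ⟨q1, h1, rfl⟩ ⟨q2, h2, rfl⟩
  rw [M.deterministic _ _ _ _ h1 h2]

theorem recv_of {A S : Type} {M : Machine A S} {q q' : S} {a : A}
    (h : M.trans q (.recv a) q') : M.Receiving q :=
  ⟨fun hf => hf _ _ h, fun _ _ h' => M.directed _ _ _ _ _ h' h⟩

theorem send_of {A S : Type} {M : Machine A S} {q q' : S} {a : A}
    (h : M.trans q (.send a) q') : M.Sending q :=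
  ⟨fun hf => hf _ _ h, fun _ _ h' => M.directed _ _ _ _ _ h' h⟩

theorem inTree_send {A S : Type} {M : Machine A S} {q : S} (h : M.Sending q) :
    InTree M q (.leaf q) := by
  refine .leaf ?_
  ext a
  simp only [Set.mem_empty_iff_false, iff_false]
  rintro ⟨q', hq⟩
  exact absurd (h.2 _ _ hq) (by simp [Act.dir])

theorem step_pres {A P Q : Type} {M1 : Machine A P} {M2 : Machine A Q}
    {R : P → ITree A Q → Prop} (hR : IsSubtypingRel M1 M2 R)
    {c c' : P × ITree A Q} {l : Act A} (hc : R c.1 c.2) (hs : Step M1 M2 c l c') :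
    R c'.1 c'.2 := by
  cases hs with
  | inp h1 h2 h3 =>
    obtain ⟨p', h, hr⟩ := (((hR _ _ hc).2.1 (recv_of h1)).1 _ rfl).2 _ _ h2
    rw [M1.deterministic _ _ _ _ h1 h]; exact hr
  | out h1 h2 h3 =>
    obtain ⟨q', h, hr⟩ := ((hR _ _ hc).2.2 (send_of h1)).1 _ rfl (send_of h2) _ _ h1
    rw [M2.deterministic _ _ _ _ h2 h]; exact hr
  | inCtx ha h1 h2 =>
    obtain ⟨p', h, hr⟩ := ((hR _ _ hc).2.1 (recv_of h1)).2 _ _ _ rfl _ ha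
    rw [M1.deterministic _ _ _ _ h1 h]; exact hr
  | @outAcc p a p' T T' h1 h2 h3 =>
    have hw := RL_mono (R' := fun q t => ∃ U, InTree M2 q U ∧
              ReplaceLeaves (fun qh t' => ∃ q', M2.trans qh (.send a) q' ∧
                  t' = ITree.leaf q') U t)
      (by rintro q t ⟨U, hU, h⟩
          exact ⟨U, hU, RL_mono (fun _ _ h => h.2) h⟩) h3
    by_cases hq : ∃ q, T = ITree.leaf q ∧ M2.Sending q
    · obtain ⟨q, rfl, hq⟩ := hq
      obtain ⟨q', h, hr⟩ := ((hR _ _ hc).2.2 (send_of h1)).1 _ rfl hq _ _ h1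
      have : T' = .leaf q' := acc_fun hw
        (.leaf ⟨_, inTree_send hq, .leaf ⟨q', h, rfl⟩⟩)
      rw [this]; exact hr
    · obtain ⟨T2, h, hr⟩ := (((hR _ _ hc).2.2 (send_of h1)).2 hq).2.2 _ _ h1
      rw [acc_fun hw h]; exact hr

theorem progress {A P Q : Type} {M1 : Machine A P} {M2 : Machine A Q}
    {R : P → ITree A Q → Prop} (hR : IsSubtypingRel M1 M2 R)
    {p : P} {T : ITree A Q} (hc : R p T) (hleaf : ∀ l c', ¬ Step M1 M2 (p, T) l c') :
    SuccessfulConfig M1 M2 (p, T) := by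
  by_cases hf : M1.Final p
  · obtain ⟨q, rfl, hq⟩ := (hR _ _ hc).1 hf
    exact ⟨p, q, rfl, hf, hq⟩
  exfalso
  have hf' := hf
  simp only [Machine.Final, not_forall, not_not] at hf'
  obtain ⟨l, p', h1⟩ := hf'
  cases l with
  | recv a =>
    have H := (hR _ _ hc).2.1 (recv_of h1)
    cases T with
    | leaf q =>
      obtain ⟨hq, hh⟩ := H.1 _ rfl
      have hq' := hq.1
      simp only [Machine.Final, not_forall, not_not] at hq'
      obtain ⟨l, q', h2⟩ := hq'
      cases l with
      | send b => exact absurd (hq.2 _ _ h2) (by simp [Act.dir])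
      | recv b =>
        obtain ⟨p2, h3, _⟩ := hh _ _ h2
        refine hleaf _ _ (.inp h3 h2 ?_)
        rintro x ⟨q3, hx⟩
        obtain ⟨p3, h, _⟩ := hh _ _ hx
        exact ⟨p3, h⟩
    | node dom hne f =>
      obtain ⟨b, hb⟩ := hne
      obtain ⟨p2, h3, _⟩ := H.2 _ _ _ rfl b hb
      refine hleaf _ _ (.inCtx hb h3 ?_)
      intro x hx
      obtain ⟨p3, h, _⟩ := H.2 _ _ _ rfl x hx
      exact ⟨p3, h⟩
  | send a =>
    have H := (hR _ _ hc).2.2 (send_of h1)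
    by_cases hq : ∃ q, T = ITree.leaf q ∧ M2.Sending q
    · obtain ⟨q, rfl, hq⟩ := hq
      obtain ⟨q', h2, _⟩ := H.1 _ rfl hq _ _ h1
      refine hleaf _ _ (.out h1 h2 ?_)
      rintro x ⟨p3, hx⟩
      obtain ⟨q3, h, _⟩ := H.1 _ rfl hq _ _ hx
      exact ⟨q3, h⟩
    · obtain ⟨hcyc, _, hh⟩ := H.2 hq
      obtain ⟨T', hT', _⟩ := hh _ _ h1
      have hb : ∀ b ∈ M1.outSet p, ∃ Tb, ReplaceLeaves (fun q t => ∃ U, InTree M2 q U ∧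
              ReplaceLeaves (fun qh t' => ∃ q', M2.trans qh (.send b) q' ∧
                  t' = ITree.leaf q') U t) T Tb := by
        rintro b ⟨pb, hpb⟩
        obtain ⟨Tb, h, _⟩ := hh _ _ hpb
        exact ⟨Tb, h⟩
      refine hleaf _ _ (.outAcc h1 hcyc (RL_mono ?_ (RL_and
        (Rb := fun b q t => ∃ U, InTree M2 q U ∧
              ReplaceLeaves (fun qh t' => ∃ q', M2.trans qh (.send b) q' ∧
                  t' = ITree.leaf q') U t) hT' hb)))
      rintro q t ⟨⟨U, hU, h⟩, hbs⟩
      refine ⟨U, hU, RL_mono ?_ (RL_and (B := M1.outSet p)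
        (Rb := fun b qh t' => ∃ q', M2.trans qh (.send b) q' ∧
                  t' = ITree.leaf q') h ?_)⟩
      · rintro q t ⟨h, hbs⟩
        refine ⟨fun b hb => ?_, h⟩
        obtain ⟨_, q', h, _⟩ := hbs b hb
        exact ⟨q', h⟩
      · intro b hb
        obtain ⟨tb, U', hU', h'⟩ := hbs b hb
        obtain rfl := InTree_fun hU hU'
        exact ⟨tb, h'⟩

/-- If `simtree(M₁,M₂)` contains an unsuccessful leaf (a node
with no successors whose label is not a pair of final states), then `M₁ ≰ M₂`. -/
theorem not_subtyping_of_unsuccessful_leaf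
    {A P Q : Type} [Fintype A] [Fintype P] [Fintype Q]
    (M1 : Machine A P) (M2 : Machine A Q)
    (c : P × ITree A Q) (hreach : CReach M1 M2 c)
    (hleaf : ∀ ℓ c', ¬ Step M1 M2 c ℓ c')
    (hfail : ¬ SuccessfulConfig M1 M2 c) :
    ¬ Subtyping M1 M2 := by
  rintro ⟨R, hR, h0⟩
  have hc : ∀ d, CReach M1 M2 d → R d.1 d.2 := by
    intro d hd
    unfold CReach at hd
    induction hd with
    | refl => exact h0
    | tail _ hs ih =>
      obtain ⟨l, hs⟩ := hs
      exact step_pres hR ih hs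
  exact hfail (progress hR (hc c hreach) hleaf)

end AsyncSession
end
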